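/- (Per-iteration descent, strong positive curvature case with a large step.) Let f : ℝ^d → ℝ be twice continuously differentiable and satisfy Hessian directional smoothness with constant L₂ > 0, let ρ ∈ (0, 1/2) and σ > 0. Fix x with g(x) ≠ 0, suppose ⟨g(x), H(x) g(x)⟩ > σ‖g(x)‖², and let p = −s g(x) with 0 < s ≤ 1/σ satisfying the second-order descent condition ⟨g(x), p⟩ + ⟨p, H(x) p⟩ ≤ 0. If ‖p‖ ≥ 6σ(1/2 − ρ)/L₂, then the step size α = √(6σ(1/2 − ρ)/(L₂‖p‖)) lies in (0, 1], satisfies the Armijo condition, and yields f(x + α p) ≤ f(x) − ρ σ (6σ(1/2 − ρ)/L₂)². -/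

import Mathlib

open scoped RealInnerProductSpace

/-- The Hessian of `f` at `x`, as a continuous linear map. -/
noncomputable def hessian {d : ℕ} (f : EuclideanSpace ℝ (Fin d) → ℝ)
    (x : EuclideanSpace ℝ (Fin d)) :
    EuclideanSpace ℝ (Fin d) →L[ℝ] EuclideanSpace ℝ (Fin d) :=
  fderiv ℝ (gradient f) x

open Set in
/-- Integrating twice an affine upper bound on the second derivative. -/
theorem taylor_upper_bound_of_deriv2_le {φ φ' φ'' : ℝ → ℝ} {a b : ℝ}
    (h1 : ∀ t, HasDerivAt φ (φ' t) t) (h2 : ∀ t, HasDerivAt φ' (φ'' t) t)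
    (hb : ∀ t, 0 ≤ t → φ'' t ≤ a + b * t) {t : ℝ} (ht : 0 ≤ t) :
    φ t ≤ φ 0 + φ' 0 * t + a * t ^ 2 / 2 + b * t ^ 3 / 6 := by
  have antitone_of_deriv_nonpos {u u' : ℝ → ℝ} (hu : ∀ t, HasDerivAt u (u' t) t)
      (hu' : ∀ t, 0 ≤ t → u' t ≤ 0) : AntitoneOn u (Ici 0) :=
    antitoneOn_of_hasDerivWithinAt_nonpos (convex_Ici 0)
      (fun t _ => (hu t).continuousAt.continuousWithinAt)
      (fun t _ => (hu t).hasDerivWithinAt)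
      (fun t ht => hu' t (interior_subset ht))
  have hφ' : ∀ t, 0 ≤ t → φ' t ≤ φ' 0 + a * t + b * t ^ 2 / 2 := by
    intro t ht
    have hd : ∀ t, HasDerivAt (fun t => φ' t - (a * t + b * t ^ 2 / 2))
        (φ'' t - (a + b * t)) t := fun t => by
      refine ((h2 t).sub (((hasDerivAt_id t).const_mul a).add
        ((((hasDerivAt_id t).pow 2).const_mul b).div_const 2))).congr_deriv ?_
      simp only [id]
      ring
    have := antitone_of_deriv_nonpos hd (fun t ht => by linarith [hb t ht])
      self_mem_Ici ht ht
    norm_num at this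
    linarith
  have hd : ∀ t, HasDerivAt (fun t => φ t - (φ' 0 * t + a * t ^ 2 / 2 + b * t ^ 3 / 6))
      (φ' t - (φ' 0 + a * t + b * t ^ 2 / 2)) t := fun t => by
    refine ((h1 t).sub ((((hasDerivAt_id t).const_mul (φ' 0)).add
      ((((hasDerivAt_id t).pow 2).const_mul a).div_const 2)).add
      ((((hasDerivAt_id t).pow 3).const_mul b).div_const 6))).congr_deriv ?_
    simp only [id]
    ring
  have := antitone_of_deriv_nonpos hd (fun t ht => by linarith [hφ' t ht])
    self_mem_Ici ht ht
  norm_num at this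
  linarith

/-- The gradient of a `C²` function is differentiable. -/
theorem ContDiff.differentiable_gradient {F : Type*} [NormedAddCommGroup F]
    [InnerProductSpace ℝ F] [CompleteSpace F] {f : F → ℝ} (hf : ContDiff ℝ 2 f) :
    Differentiable ℝ (gradient f) :=
  (InnerProductSpace.toDual ℝ F).symm.toContinuousLinearEquiv.differentiable.comp
    ((hf.fderiv_right (m := 1) (by norm_num)).differentiable (by norm_num))

/-- Cubic upper model along a ray on which the Hessian is Lipschitz at the base point. -/
theorem cubic_upper_bound {d : ℕ} {f : EuclideanSpace ℝ (Fin d) → ℝ} (hf : ContDiff ℝ 2 f)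
    {x p : EuclideanSpace ℝ (Fin d)} {L : ℝ}
    (hL : ∀ t : ℝ, 0 ≤ t → ‖hessian f (x + t • p) - hessian f x‖ ≤ L * (t * ‖p‖))
    {t : ℝ} (ht : 0 ≤ t) :
    f (x + t • p) ≤ f x + ⟪gradient f x, p⟫ * t + ⟪p, hessian f x p⟫ * t ^ 2 / 2
      + L * ‖p‖ ^ 3 * t ^ 3 / 6 := by
  have hray : ∀ t : ℝ, HasDerivAt (fun t : ℝ => x + t • p) p t := fun t => by
    simpa using ((hasDerivAt_id t).smul_const p).const_add x
  have h1 : ∀ t : ℝ, HasDerivAt (fun t : ℝ => f (x + t • p)) ⟪gradient f (x + t • p), p⟫ t :=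
    fun t => by
      have hg := ((hf.differentiable (by norm_num)) (x + t • p)).hasGradientAt.hasFDerivAt
      exact (hg.comp_hasDerivAt t (hray t)).congr_deriv (by simp)
  have h2 : ∀ t : ℝ, HasDerivAt (fun t : ℝ => ⟪gradient f (x + t • p), p⟫)
      ⟪hessian f (x + t • p) p, p⟫ t := fun t => by
    have hg := (hf.differentiable_gradient (x + t • p)).hasFDerivAt.comp_hasDerivAt t (hray t)
    exact (hg.inner ℝ (hasDerivAt_const t p)).congr_deriv (by simp [hessian])
  have hb : ∀ t : ℝ, 0 ≤ t → ⟪hessian f (x + t • p) p, p⟫ ≤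
      ⟪p, hessian f x p⟫ + L * ‖p‖ ^ 3 * t := fun t ht => by
    have h := calc
      ⟪(hessian f (x + t • p) - hessian f x) p, p⟫
          ≤ ‖(hessian f (x + t • p) - hessian f x) p‖ * ‖p‖ := real_inner_le_norm _ _
      _ ≤ (L * (t * ‖p‖) * ‖p‖) * ‖p‖ := by
        gcongr
        exact ContinuousLinearMap.le_of_opNorm_le _ (hL t ht) p
    rw [sub_apply, inner_sub_left, real_inner_comm p (hessian f x p)] at h
    linarith
  simpa using taylor_upper_bound_of_deriv2_le h1 h2 hb ht

/-- Per-iteration descent in the strong positive curvature case with a large step. -/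
theorem stmt_12 {d : ℕ} (f : EuclideanSpace ℝ (Fin d) → ℝ) (hf : ContDiff ℝ 2 f)
    (L₂ : ℝ) (hL₂ : 0 < L₂)
    (hsmooth : ∀ x : EuclideanSpace ℝ (Fin d), ∀ t : ℝ, 0 ≤ t →
      ‖hessian f (x - t • gradient f x) - hessian f x‖ ≤ t * L₂ * ‖gradient f x‖)
    (ρ σ : ℝ) (hρ : ρ ∈ Set.Ioo (0 : ℝ) (1 / 2)) (hσ : 0 < σ)
    (x : EuclideanSpace ℝ (Fin d)) (hgx : gradient f x ≠ 0)
    (hSPC : σ * ‖gradient f x‖ ^ 2 < ⟪gradient f x, hessian f x (gradient f x)⟫)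
    (s : ℝ) (hs0 : 0 < s) (hs1 : s ≤ 1 / σ)
    (p : EuclideanSpace ℝ (Fin d)) (hp : p = -(s • gradient f x))
    (hdesc : ⟪gradient f x, p⟫ + ⟪p, hessian f x p⟫ ≤ 0)
    (hbig : 6 * σ * (1 / 2 - ρ) / L₂ ≤ ‖p‖)
    (α : ℝ) (hα : α = Real.sqrt (6 * σ * (1 / 2 - ρ) / (L₂ * ‖p‖))) :
    (0 < α ∧ α ≤ 1) ∧
      f (x + α • p) ≤ f x + ρ * α * ⟪p, gradient f x⟫ ∧
      f (x + α • p) ≤ f x - ρ * σ * (6 * σ * (1 / 2 - ρ) / L₂) ^ 2 := by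
  have hp0 : 0 < ‖p‖ := by
    rw [hp, norm_neg, norm_smul, Real.norm_of_nonneg hs0.le]
    exact mul_pos hs0 (norm_pos_iff.2 hgx)
  have hρ' : 0 < 1 / 2 - ρ := sub_pos.2 hρ.2
  set c := 6 * σ * (1 / 2 - ρ) / L₂ with hc
  have hc0 : 0 < c := by positivity
  have hcL : c * L₂ = 6 * σ * (1 / 2 - ρ) := div_mul_cancel₀ _ hL₂.ne'
  rw [← div_div, ← hc] at hα
  have hα0 : 0 < α := hα ▸ Real.sqrt_pos.2 (div_pos hc0 hp0)
  have hα1 : α ≤ 1 := by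
    rw [hα, Real.sqrt_le_one, div_le_one hp0]
    exact hbig
  have hαsq : α ^ 2 * ‖p‖ = c := by
    rw [hα, Real.sq_sqrt (by positivity), div_mul_cancel₀ _ hp0.ne']
  have hgp : ⟪gradient f x, p⟫ ≤ -(σ * ‖p‖ ^ 2) := by
    have hsσ : s * σ ≤ 1 := (le_div_iff₀ hσ).1 hs1
    rw [hp, inner_neg_right, inner_smul_right, real_inner_self_eq_norm_sq, norm_neg, norm_smul,
      Real.norm_of_nonneg hs0.le]
    have := mul_le_mul_of_nonneg_right hsσ (by positivity : 0 ≤ s * ‖gradient f x‖ ^ 2)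
    linarith
  have hL : ∀ t : ℝ, 0 ≤ t → ‖hessian f (x + t • p) - hessian f x‖ ≤ L₂ * (t * ‖p‖) := by
    intro t ht
    have h := hsmooth x (t * s) (by positivity)
    have hx : x + t • p = x - (t * s) • gradient f x := by
      rw [hp, smul_neg, smul_smul, sub_eq_add_neg]
    rw [hx, hp, norm_neg, norm_smul, Real.norm_of_nonneg hs0.le]
    linarith
  have hcubic := cubic_upper_bound hf hL hα0.le
  have hthird : L₂ * ‖p‖ ^ 3 * α ^ 3 / 6 = α * (1 / 2 - ρ) * (σ * ‖p‖ ^ 2) := by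
    linear_combination (L₂ * ‖p‖ ^ 2 * α / 6) * hαsq + (‖p‖ ^ 2 * α / 6) * hcL
  have harmijo : f (x + α • p) ≤ f x + ρ * α * ⟪p, gradient f x⟫ := by
    rw [hthird] at hcubic
    rw [real_inner_comm]
    have hg0 : 0 ≤ -⟪gradient f x, p⟫ := by
      have : 0 ≤ σ * ‖p‖ ^ 2 := by positivity
      linarith
    have e1 := mul_le_mul_of_nonneg_left hdesc (sq_nonneg α)
    have e2 := mul_le_mul_of_nonneg_left hgp (by positivity : 0 ≤ α * (1 / 2 - ρ))
    have e3 := mul_nonneg (mul_nonneg hα0.le (sub_nonneg.2 hα1)) hg0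
    linarith
  refine ⟨⟨hα0, hα1⟩, harmijo, harmijo.trans ?_⟩
  have hdecrease : c ^ 2 ≤ α * ‖p‖ ^ 2 := calc
    c ^ 2 = c * c := sq c
    _ ≤ c * ‖p‖ := by gcongr
    _ = α * (α * ‖p‖ ^ 2) := by rw [← hαsq]; ring
    _ ≤ α * ‖p‖ ^ 2 := by
      gcongr
      exact mul_le_of_le_one_left (by positivity) hα1
  have e1 := mul_le_mul_of_nonneg_left hgp (mul_nonneg hρ.1.le hα0.le)
  have e2 := mul_le_mul_of_nonneg_left hdecrease (mul_nonneg hρ.1.le hσ.le)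
  rw [real_inner_comm]
  linarith
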